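/- arXiv:math/0011205 — 3 statements merged into one kernel-verified Lean document; each statement's English description precedes it below -/
import Mathlib

section
/- Let X and Y be derivations on ℂ[x,y,z], each of the form a·∂/∂x + b·∂/∂y + c·∂/∂z with a, b, c homogeneous polynomials of the same degree m ≥ 1, and suppose that for every (s,t) ∈ ℂ² with (s,t) ≠ (0,0) the derivation sX + tY is not a polynomial multiple of the Euler derivation. For each integer d ≥ 1 let S_d be the set of points [s:t] of the projectivization of ℂ² such that the derivation sX + tY admits a rational first integral of degree at most d. If S_d is finite for every d ≥ 1, then there exists a constant C > 0 such that for all d ≥ 1 the cardinality of S_d is at most C·d⁴. -/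
open MvPolynomial

/-- `D` admits a rational first integral of degree `e`: there are `ℂ`-linearly independent
homogeneous polynomials `F`, `G` of degree `e` with `G·D(F) = F·D(G)`. -/
def HasRatFirstIntegral
    (D : Derivation ℂ (MvPolynomial (Fin 3) ℂ) (MvPolynomial (Fin 3) ℂ)) (e : ℕ) : Prop :=
  ∃ F G : MvPolynomial (Fin 3) ℂ, F.IsHomogeneous e ∧ G.IsHomogeneous e ∧
    LinearIndependent ℂ ![F, G] ∧ G * D F = F * D G

/-- The set of points `[s:t]` of the projective line such that `s·Dx + t·Dy` admits a
rational first integral of degree at most `d`. -/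
def FIParams (Dx Dy : Derivation ℂ (MvPolynomial (Fin 3) ℂ) (MvPolynomial (Fin 3) ℂ))
    (d : ℕ) : Set (Projectivization ℂ (Fin 2 → ℂ)) :=
  {P | ∃ (s t : ℂ) (h : ![s, t] ≠ 0), P = Projectivization.mk ℂ ![s, t] h ∧
    ∃ e, 1 ≤ e ∧ e ≤ d ∧ HasRatFirstIntegral (s • Dx + t • Dy) e}

/-- The derivation `z·D - D(z)·R`, where `R` is the Euler derivation. It annihilates `z` and
has the same homogeneous rational first integrals as `D`. -/
noncomputable def projDerivation
    (D : Derivation ℂ (MvPolynomial (Fin 3) ℂ) (MvPolynomial (Fin 3) ℂ)) :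
    Derivation ℂ (MvPolynomial (Fin 3) ℂ) (MvPolynomial (Fin 3) ℂ) :=
  (X 2 : MvPolynomial (Fin 3) ℂ) • D - D (X 2) • mkDerivation ℂ X

lemma projDerivation_apply
    (D : Derivation ℂ (MvPolynomial (Fin 3) ℂ) (MvPolynomial (Fin 3) ℂ))
    (F : MvPolynomial (Fin 3) ℂ) :
    projDerivation D F = X 2 * D F - D (X 2) * mkDerivation ℂ X F := by
  simp [projDerivation]

lemma projDerivation_X_two
    (D : Derivation ℂ (MvPolynomial (Fin 3) ℂ) (MvPolynomial (Fin 3) ℂ)) :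
    projDerivation D (X 2) = 0 := by
  rw [projDerivation_apply, mkDerivation_X]; ring

lemma projDerivation_smul_add
    (A B : Derivation ℂ (MvPolynomial (Fin 3) ℂ) (MvPolynomial (Fin 3) ℂ)) (s t : ℂ) :
    projDerivation (s • A + t • B) = s • projDerivation A + t • projDerivation B := by
  ext1 i
  simp only [projDerivation_apply, Derivation.add_apply, Derivation.smul_apply, smul_eq_C_mul]
  ring

lemma derivation_apply_eq_sum_pderiv
    (D : Derivation ℂ (MvPolynomial (Fin 3) ℂ) (MvPolynomial (Fin 3) ℂ))
    (F : MvPolynomial (Fin 3) ℂ) : D F = ∑ i, D (X i) * pderiv i F := by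
  have h : D = ∑ i, D (X i) • pderiv i := by
    ext1 j
    rw [← Derivation.coeFnAddMonoidHom_apply (∑ i, D (X i) • pderiv i), map_sum]
    simp [Derivation.coeFnAddMonoidHom_apply, pderiv_X, Pi.single_apply]
  conv_lhs => rw [h]
  rw [← Derivation.coeFnAddMonoidHom_apply (∑ i, D (X i) • pderiv i), map_sum]
  simp [Derivation.coeFnAddMonoidHom_apply]

lemma euler_apply {e : ℕ} {F : MvPolynomial (Fin 3) ℂ} (hF : F.IsHomogeneous e) :
    mkDerivation ℂ X F = (e : MvPolynomial (Fin 3) ℂ) * F := by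
  rw [derivation_apply_eq_sum_pderiv]
  simp only [mkDerivation_X]
  rw [hF.sum_X_mul_pderiv, nsmul_eq_mul]

lemma projDerivation_firstIntegral_iff
    (D : Derivation ℂ (MvPolynomial (Fin 3) ℂ) (MvPolynomial (Fin 3) ℂ)) (e : ℕ) :
    HasRatFirstIntegral (projDerivation D) e ↔ HasRatFirstIntegral D e := by
  unfold HasRatFirstIntegral
  refine exists₂_congr fun F G => and_congr_right fun hF => and_congr_right fun hG =>
    and_congr_right fun _ => ?_
  rw [projDerivation_apply, projDerivation_apply, euler_apply hF, euler_apply hG]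
  constructor
  · intro h
    apply mul_left_cancel₀ (X_ne_zero (2 : Fin 3) : (X 2 : MvPolynomial (Fin 3) ℂ) ≠ 0)
    linear_combination h
  · intro h
    linear_combination X 2 * h

lemma derivation_isHomogeneous
    {D : Derivation ℂ (MvPolynomial (Fin 3) ℂ) (MvPolynomial (Fin 3) ℂ)} {m : ℕ}
    (hD : ∀ i, (D (X i)).IsHomogeneous (m + 1)) {k : ℕ} {F : MvPolynomial (Fin 3) ℂ}
    (hF : F.IsHomogeneous k) : (D F).IsHomogeneous (k + m) := by
  rcases Nat.eq_zero_or_pos k with rfl | hk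
  · rw [← totalDegree_zero_iff_isHomogeneous, totalDegree_eq_zero_iff_eq_C] at hF
    rw [hF, show C (coeff 0 F) = algebraMap ℂ (MvPolynomial (Fin 3) ℂ) (coeff 0 F) from rfl,
      D.map_algebraMap]
    exact isHomogeneous_zero _ _ _
  · rw [derivation_apply_eq_sum_pderiv]
    refine IsHomogeneous.sum _ _ _ fun i _ => ?_
    have := (hD i).mul (hF.pderiv (i := i))
    rwa [show m + 1 + (k - 1) = k + m by omega] at this

lemma projDerivation_isHomogeneous
    {D : Derivation ℂ (MvPolynomial (Fin 3) ℂ) (MvPolynomial (Fin 3) ℂ)} {m : ℕ}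
    (hD : ∀ i, (D (X i)).IsHomogeneous m) (i : Fin 3) :
    (projDerivation D (X i)).IsHomogeneous (m + 1) := by
  rw [projDerivation_apply, mkDerivation_X]
  refine IsHomogeneous.sub ?_ ((hD 2).mul (isHomogeneous_X _ _))
  rw [add_comm]
  exact (isHomogeneous_X _ _).mul (hD i)

lemma derivation_iterate_isHomogeneous
    {D : Derivation ℂ (MvPolynomial (Fin 3) ℂ) (MvPolynomial (Fin 3) ℂ)} {m : ℕ}
    (hD : ∀ i, (D (X i)).IsHomogeneous (m + 1)) {k : ℕ} {F : MvPolynomial (Fin 3) ℂ}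
    (hF : F.IsHomogeneous k) (i : ℕ) : (D^[i] F).IsHomogeneous (k + i * m) := by
  induction i with
  | zero => simpa using hF
  | succ i ih =>
    rw [Function.iterate_succ_apply']
    convert derivation_isHomogeneous hD ih using 1
    ring

/-- The Wronskian matrix of a family of polynomials with respect to a derivation. -/
noncomputable def wronskianMatrix (D : Derivation ℂ (MvPolynomial (Fin 3) ℂ) (MvPolynomial (Fin 3) ℂ))
    {n : ℕ} (f : Fin n → MvPolynomial (Fin 3) ℂ) :
    Matrix (Fin n) (Fin n) (MvPolynomial (Fin 3) ℂ) :=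
  Matrix.of fun i j => D^[i] (f j)

lemma det_isHomogeneous {n : ℕ} {M : Matrix (Fin n) (Fin n) (MvPolynomial (Fin 3) ℂ)}
    {r : Fin n → ℕ} (h : ∀ i j, (M i j).IsHomogeneous (r i)) :
    M.det.IsHomogeneous (∑ i, r i) := by
  rw [Matrix.det_apply]
  refine IsHomogeneous.sum _ _ _ fun σ _ => ?_
  have hp : (∏ i, M (σ i) i).IsHomogeneous (∑ i, r i) := by
    rw [← Equiv.sum_comp σ r]
    exact IsHomogeneous.prod _ _ _ fun i _ => h _ _
  rcases Int.units_eq_one_or (Equiv.Perm.sign σ) with h | h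
  · simpa [h] using hp
  · simpa [h] using hp.neg

lemma linearIndependent_pair_of_forall_ne {P Q : MvPolynomial (Fin 3) ℂ} (hQ : Q ≠ 0)
    (h : ∀ a : ℂ, P ≠ a • Q) : LinearIndependent ℂ ![P, Q] := by
  rw [LinearIndependent.pair_symm_iff, LinearIndependent.pair_iff' hQ]
  exact fun a ha => h a ha.symm

/-- If the Wronskian of a linearly independent family of forms of the same degree vanishes,
then the derivation has a rational first integral. -/
lemma exists_firstIntegral_of_det_eq_zero
    {D : Derivation ℂ (MvPolynomial (Fin 3) ℂ) (MvPolynomial (Fin 3) ℂ)} {m : ℕ}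
    (hD : ∀ i, (D (X i)).IsHomogeneous (m + 1)) {d : ℕ} (hd : 1 ≤ d) {n : ℕ}
    (f : Fin n → MvPolynomial (Fin 3) ℂ) (hf : ∀ j, (f j).IsHomogeneous d)
    (hli : LinearIndependent ℂ f) (hdet : (wronskianMatrix D f).det = 0) :
    ∃ e, 1 ≤ e ∧ HasRatFirstIntegral D e := by
  induction n with
  | zero => simp at hdet
  | succ n ih =>
    set g : Fin n → MvPolynomial (Fin 3) ℂ := fun j => f j.castSucc with hg
    have hgli : LinearIndependent ℂ g := hli.comp _ (Fin.castSucc_injective n)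
    by_cases hA : (wronskianMatrix D g).det = 0
    · exact ih g (fun j => hf _) hgli hA
    set A := wronskianMatrix D g with hAdef
    set u := f (Fin.last n) with hu
    set b : Fin n → MvPolynomial (Fin 3) ℂ := fun i => D^[i] u with hb
    set c := A.cramer b with hc
    have hker : ∀ v, A.mulVec v = 0 → v = 0 := fun v hv => by
      by_contra hv0
      exact hA (Matrix.exists_mulVec_eq_zero_iff.mp ⟨v, hv0, hv⟩)
    have hlow : A.mulVec c = A.det • b := Matrix.mulVec_cramer A b
    obtain ⟨w, hw0, hw⟩ := Matrix.exists_mulVec_eq_zero_iff.mpr hdet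
    have hwi : ∀ i, i ≤ n →
        ∑ j : Fin n, D^[i] (g j) * w j.castSucc + D^[i] u * w (Fin.last n) = 0 := by
      intro i hi
      have := congrFun hw ⟨i, by omega⟩
      simpa [Matrix.mulVec, dotProduct, wronskianMatrix, Fin.sum_univ_castSucc] using this
    have hlast : w (Fin.last n) ≠ 0 := by
      intro h0
      have : (fun j : Fin n => w j.castSucc) = 0 := by
        apply hker
        funext i
        have := hwi i i.2.le
        simpa [Matrix.mulVec, dotProduct, hAdef, wronskianMatrix, h0] using this
      apply hw0
      funext j
      refine Fin.lastCases h0 (fun j => ?_) j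
      exact congrFun this j
    have hcw : ∀ j : Fin n, w (Fin.last n) * c j = - (A.det * w j.castSucc) := by
      have : (fun j : Fin n => w (Fin.last n) * c j + A.det * w j.castSucc) = 0 := by
        apply hker
        have h1 : (fun j : Fin n => w (Fin.last n) * c j + A.det * w j.castSucc)
            = w (Fin.last n) • c + A.det • (fun j : Fin n => w j.castSucc) := rfl
        rw [h1, Matrix.mulVec_add, Matrix.mulVec_smul, Matrix.mulVec_smul, hlow]
        funext i
        have := hwi i i.2.le
        have h2 : A.mulVec (fun j : Fin n => w j.castSucc) i
            = ∑ j : Fin n, D^[i] (g j) * w j.castSucc := rfl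
        simp only [Pi.add_apply, Pi.smul_apply, smul_eq_mul, h2, hb, Pi.zero_apply]
        linear_combination A.det * this
      intro j
      have := congrFun this j
      simp only [Pi.zero_apply] at this
      linear_combination this
    have hrel : ∀ i, i ≤ n → ∑ j : Fin n, D^[i] (g j) * c j = A.det * D^[i] u := by
      intro i hi
      apply mul_left_cancel₀ hlast
      have h1 : w (Fin.last n) * ∑ j : Fin n, D^[i] (g j) * c j
          = - A.det * ∑ j : Fin n, D^[i] (g j) * w j.castSucc := by
        rw [Finset.mul_sum, Finset.mul_sum]
        refine Finset.sum_congr rfl fun j _ => ?_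
        linear_combination D^[i] (g j) * hcw j
      rw [h1]
      linear_combination (-A.det) * hwi i hi
    have hconst : ∀ j, A.det * D (c j) = c j * D A.det := by
      have : (fun j : Fin n => A.det * D (c j) - D A.det * c j) = 0 := by
        apply hker
        funext i
        have h0 := hrel i i.2.le
        have h1 := hrel (i + 1) i.2
        have h2 := congrArg D h0
        rw [map_sum] at h2
        simp only [Derivation.leibniz, smul_eq_mul, Finset.sum_add_distrib,
          ← Function.iterate_succ_apply' (f := D)] at h2
        have h3 : ∑ j : Fin n, c j * D^[(i : ℕ) + 1] (g j) = A.det * D^[(i : ℕ) + 1] u := by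
          rw [← h1]
          exact Finset.sum_congr rfl fun j _ => mul_comm _ _
        have h4 : A.mulVec (fun j : Fin n => A.det * D (c j) - D A.det * c j) i
            = A.det * ∑ j : Fin n, D^[i] (g j) * D (c j)
              - D A.det * ∑ j : Fin n, D^[i] (g j) * c j := by
          rw [Finset.mul_sum, Finset.mul_sum, ← Finset.sum_sub_distrib]
          change ∑ j : Fin n, D^[i] (g j) * (A.det * D (c j) - D A.det * c j) = _
          exact Finset.sum_congr rfl fun j _ => by ring
        rw [h4, h0]
        simp only [Pi.zero_apply]
        simp only [Nat.succ_eq_add_one] at h2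
        linear_combination A.det * h2 - A.det * h3
      intro j
      have := congrFun this j
      simp only [Pi.zero_apply] at this
      linear_combination this
    have hex : ∃ j, ∀ a : ℂ, c j ≠ a • A.det := by
      by_contra! hcon
      choose a ha using hcon
      have h0 := hrel 0 (Nat.zero_le _)
      simp only [Function.iterate_zero, id] at h0
      have h1 : ∑ j, a j • g j = u := by
        apply mul_left_cancel₀ hA
        rw [← h0, Finset.mul_sum]
        refine Finset.sum_congr rfl fun j _ => ?_
        rw [ha j, mul_smul_comm, mul_smul_comm, mul_comm]
      have h2 := Fintype.linearIndependent_iff.mp hli (Fin.snoc a (-1)) (by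
        rw [Fin.sum_univ_castSucc]
        simp only [Fin.snoc_castSucc, Fin.snoc_last]
        change ∑ j, a j • g j + (-1 : ℂ) • u = 0
        rw [h1]; simp) (Fin.last n)
      simp at h2
    obtain ⟨j, hj⟩ := hex
    refine ⟨∑ i : Fin n, (d + i * m), ?_, c j, A.det, ?_, ?_, ?_, hconst j⟩
    · calc 1 ≤ d + j * m := by omega
        _ ≤ _ := Finset.single_le_sum (f := fun i : Fin n => d + i * m)
          (fun _ _ => Nat.zero_le _) (Finset.mem_univ j)
    · rw [hc, Matrix.cramer_apply]
      refine det_isHomogeneous fun i k => ?_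
      rw [Matrix.updateCol_apply]
      split_ifs
      · exact derivation_iterate_isHomogeneous hD (hf _) _
      · exact derivation_iterate_isHomogeneous hD (hf _) _
    · exact det_isHomogeneous fun i k => derivation_iterate_isHomogeneous hD (hf _) _
    · exact linearIndependent_pair_of_forall_ne hA hj

lemma mul_iterate_comm_of_firstIntegral
    {D : Derivation ℂ (MvPolynomial (Fin 3) ℂ) (MvPolynomial (Fin 3) ℂ)}
    {F G : MvPolynomial (Fin 3) ℂ} (hG : G ≠ 0) (h : G * D F = F * D G) (i : ℕ) :
    G * D^[i] F = F * D^[i] G := by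
  induction i with
  | zero => simp [mul_comm]
  | succ i ih =>
    have h2 := congrArg D ih
    simp only [Derivation.leibniz, smul_eq_mul, ← Function.iterate_succ_apply' (f := D)] at h2
    apply mul_left_cancel₀ hG
    simp only [Nat.succ_eq_add_one] at h2
    linear_combination G * h2 - D G * ih + D^[i] G * h

lemma derivation_iterate_sum_smul
    (D : Derivation ℂ (MvPolynomial (Fin 3) ℂ) (MvPolynomial (Fin 3) ℂ)) {n : ℕ}
    (f : Fin n → MvPolynomial (Fin 3) ℂ) (a : Fin n → ℂ) (i : ℕ) :
    D^[i] (∑ j, a j • f j) = ∑ j, a j • D^[i] (f j) := by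
  have h : ∀ x, D^[i] x = (D.toLinearMap ^ i) x := fun x => by
    rw [Module.End.pow_apply]; rfl
  simp only [h, map_sum, map_smul]

/-- If two linearly independent polynomials in the span of a family have a quotient
annihilated by the derivation, then the Wronskian of the family vanishes. -/
lemma det_eq_zero_of_firstIntegral
    {D : Derivation ℂ (MvPolynomial (Fin 3) ℂ) (MvPolynomial (Fin 3) ℂ)} {n : ℕ}
    (f : Fin n → MvPolynomial (Fin 3) ℂ) {F G : MvPolynomial (Fin 3) ℂ} (a b : Fin n → ℂ)
    (hF : F = ∑ j, a j • f j) (hG : G = ∑ j, b j • f j)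
    (hli : LinearIndependent ℂ ![F, G]) (h : G * D F = F * D G) :
    (wronskianMatrix D f).det = 0 := by
  have hF0 : F ≠ 0 := hli.ne_zero 0
  have hG0 : G ≠ 0 := hli.ne_zero 1
  refine Matrix.exists_mulVec_eq_zero_iff.mp ⟨fun j => a j • G - b j • F, ?_, ?_⟩
  · intro h0
    obtain ⟨j, hj⟩ : ∃ j, a j ≠ 0 := by
      by_contra! hcon
      exact hF0 (by rw [hF]; simp [hcon])
    have h1 : a j • G - b j • F = 0 := congrFun h0 j
    have := LinearIndependent.pair_iff.mp hli (-b j) (a j) (by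
      rw [neg_smul, ← h1]; abel)
    exact hj this.2
  · funext i
    have h1 := mul_iterate_comm_of_firstIntegral hG0 h i
    have h2 : (wronskianMatrix D f).mulVec (fun j => a j • G - b j • F) i
        = G * ∑ j, a j • D^[i] (f j) - F * ∑ j, b j • D^[i] (f j) := by
      rw [Finset.mul_sum, Finset.mul_sum, ← Finset.sum_sub_distrib]
      change ∑ j, D^[i] (f j) * (a j • G - b j • F) = _
      refine Finset.sum_congr rfl fun j _ => ?_
      simp only [smul_eq_C_mul]
      ring
    rw [h2, ← derivation_iterate_sum_smul, ← derivation_iterate_sum_smul, ← hF, ← hG, h1,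
      sub_self]
    rfl

lemma exists_polynomial_map (A : MvPolynomial (Fin 3) ℂ →ₗ[ℂ] MvPolynomial (Fin 3) ℂ)
    {k : ℕ} (p : Polynomial (MvPolynomial (Fin 3) ℂ)) (hp : p.natDegree ≤ k) :
    ∃ q : Polynomial (MvPolynomial (Fin 3) ℂ), q.natDegree ≤ k ∧
      ∀ s : ℂ, q.eval (C s) = A (p.eval (C s)) := by
  refine ⟨∑ i ∈ Finset.range (k + 1), Polynomial.monomial i (A (p.coeff i)), ?_, fun s => ?_⟩
  · refine Polynomial.natDegree_sum_le_of_forall_le _ _ fun i hi => ?_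
    exact (Polynomial.natDegree_monomial_le _).trans (by simpa [Nat.lt_succ_iff] using hi)
  · rw [Polynomial.eval_finsetSum, Polynomial.eval_eq_sum_range' (Nat.lt_succ_of_le hp), map_sum]
    refine Finset.sum_congr rfl fun i _ => ?_
    rw [Polynomial.eval_monomial, ← C_pow, mul_comm, mul_comm (p.coeff i), ← smul_eq_C_mul,
      ← smul_eq_C_mul, map_smul]

lemma exists_polynomial_iterate
    (A B : Derivation ℂ (MvPolynomial (Fin 3) ℂ) (MvPolynomial (Fin 3) ℂ))
    (f : MvPolynomial (Fin 3) ℂ) (i : ℕ) :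
    ∃ p : Polynomial (MvPolynomial (Fin 3) ℂ), p.natDegree ≤ i ∧
      ∀ s : ℂ, p.eval (C s) = (s • A + B)^[i] f := by
  induction i with
  | zero => exact ⟨Polynomial.C f, by simp, by simp⟩
  | succ i ih =>
    obtain ⟨p, hp, hps⟩ := ih
    obtain ⟨q, hq, hqs⟩ := exists_polynomial_map A.toLinearMap p hp
    obtain ⟨r, hr, hrs⟩ := exists_polynomial_map B.toLinearMap p hp
    refine ⟨Polynomial.X * q + r, ?_, fun s => ?_⟩
    · refine Polynomial.natDegree_add_le_of_degree_le ?_ (by omega)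
      refine Polynomial.natDegree_mul_le.trans ?_
      rw [Polynomial.natDegree_X]; omega
    · rw [Function.iterate_succ_apply', Polynomial.eval_add, Polynomial.eval_mul,
        Polynomial.eval_X, hqs, hrs, hps]
      simp [smul_eq_C_mul]

lemma natDegree_det_le {n k : ℕ}
    {M : Matrix (Fin n) (Fin n) (Polynomial (MvPolynomial (Fin 3) ℂ))}
    (h : ∀ i j, (M i j).natDegree ≤ k) : M.det.natDegree ≤ n * k := by
  rw [Matrix.det_apply]
  refine Polynomial.natDegree_sum_le_of_forall_le _ _ fun σ _ => ?_
  refine (Polynomial.natDegree_smul_le _ _).trans ((Polynomial.natDegree_prod_le _ _).trans ?_)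
  refine (Finset.sum_le_card_nsmul _ _ k fun i _ => h _ _).trans ?_
  simp

/-- The Wronskian along a pencil of derivations is polynomial in the parameter. -/
lemma exists_polynomial_det
    (A B : Derivation ℂ (MvPolynomial (Fin 3) ℂ) (MvPolynomial (Fin 3) ℂ)) {n : ℕ}
    (f : Fin n → MvPolynomial (Fin 3) ℂ) :
    ∃ p : Polynomial (MvPolynomial (Fin 3) ℂ), p.natDegree ≤ n * n ∧
      ∀ s : ℂ, p.eval (C s) = (wronskianMatrix (s • A + B) f).det := by
  choose p hp hps using fun i j : Fin n => exists_polynomial_iterate A B (f j) i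
  refine ⟨(Matrix.of p).det, natDegree_det_le fun i j => (hp i j).trans i.2.le, fun s => ?_⟩
  rw [← Polynomial.coe_evalRingHom, RingHom.map_det]
  congr 1
  ext1 i j
  exact hps i j s

lemma exists_homogeneous_family (d : ℕ) :
    ∃ (n : ℕ) (f : Fin n → MvPolynomial (Fin 3) ℂ), n ≤ (d + 1) ^ 2 ∧
      (∀ j, (f j).IsHomogeneous d) ∧ LinearIndependent ℂ f ∧
      ∀ F : MvPolynomial (Fin 3) ℂ, F.IsHomogeneous d → ∃ a : Fin n → ℂ, F = ∑ j, a j • f j := by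
  let S := {u : Fin 3 →₀ ℕ // u.degree = d}
  have hsum : ∀ u : Fin 3 →₀ ℕ, u.degree = u 0 + u 1 + u 2 := fun u => by
    rw [Finsupp.degree_eq_sum, Fin.sum_univ_three]
  let φ : S → Fin (d + 1) × Fin (d + 1) := fun u =>
    (⟨u.1 0, by have := hsum u.1; have := u.2; omega⟩,
      ⟨u.1 1, by have := hsum u.1; have := u.2; omega⟩)
  have hφ : Function.Injective φ := by
    rintro ⟨u, hu⟩ ⟨v, hv⟩ h
    simp only [φ, Prod.mk.injEq, Fin.mk.injEq] at h
    have h1 := hsum u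
    have h2 := hsum v
    apply Subtype.ext
    ext i
    fin_cases i
    · exact h.1
    · exact h.2
    · change u 2 = v 2
      omega
  have : Fintype S := Fintype.ofInjective φ hφ
  let ε := (Fintype.equivFin S).symm
  refine ⟨Fintype.card S, fun j => monomial (ε j).1 1, ?_, fun j => ?_, ?_, fun F hF => ?_⟩
  · refine (Fintype.card_le_of_injective φ hφ).trans ?_
    simp [sq]
  · exact isHomogeneous_monomial _ (ε j).2
  · have := (basisMonomials (Fin 3) ℂ).linearIndependent.comp (fun j => (ε j).1)
      (Subtype.val_injective.comp ε.injective)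
    simpa [Function.comp_def] using this
  · refine ⟨fun j => coeff (ε j).1 F, ?_⟩
    rw [Equiv.sum_comp ε (fun u : S => coeff u.1 F • monomial u.1 (1 : ℂ))]
    ext v
    rw [coeff_sum]
    simp only [coeff_smul, coeff_monomial, smul_eq_mul, mul_ite, mul_one, mul_zero]
    by_cases hv : v.degree = d
    · rw [Finset.sum_eq_single (⟨v, hv⟩ : S)]
      · simp
      · rintro u - hu
        rw [if_neg]
        rintro rfl
        exact hu rfl
      · simp
    · rw [Finset.sum_eq_zero, hF.coeff_eq_zero]
      · exact hv
      · rintro u -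
        rw [if_neg]
        rintro rfl
        exact hv u.2

lemma linearIndependent_pair_mul_right {F G H : MvPolynomial (Fin 3) ℂ} (hH : H ≠ 0)
    (hli : LinearIndependent ℂ ![F, G]) : LinearIndependent ℂ ![F * H, G * H] := by
  rw [LinearIndependent.pair_iff] at hli ⊢
  intro s t h
  apply hli
  apply mul_right_cancel₀ hH
  rw [add_mul, smul_mul_assoc, smul_mul_assoc, h, zero_mul]

lemma HasRatFirstIntegral.of_le_of_map_X_two
    {D : Derivation ℂ (MvPolynomial (Fin 3) ℂ) (MvPolynomial (Fin 3) ℂ)} {e d : ℕ}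
    (h : HasRatFirstIntegral D e) (hed : e ≤ d) (hz : D (X 2) = 0) :
    HasRatFirstIntegral D d := by
  obtain ⟨F, G, hF, hG, hli, hFG⟩ := h
  have hX : (X 2 ^ (d - e) : MvPolynomial (Fin 3) ℂ).IsHomogeneous (d - e) :=
    isHomogeneous_X_pow _ _
  have hD : D (X 2 ^ (d - e)) = 0 := by rw [Derivation.leibniz_pow, hz]; simp
  refine ⟨F * X 2 ^ (d - e), G * X 2 ^ (d - e), ?_, ?_,
    linearIndependent_pair_mul_right (pow_ne_zero _ (X_ne_zero _)) hli, ?_⟩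
  · simpa [Nat.add_sub_cancel' hed] using hF.mul hX
  · simpa [Nat.add_sub_cancel' hed] using hG.mul hX
  · simp only [Derivation.leibniz, hD, smul_eq_mul, mul_zero, zero_add]
    linear_combination (X 2 ^ (d - e)) ^ 2 * hFG

lemma HasRatFirstIntegral.smul
    {D : Derivation ℂ (MvPolynomial (Fin 3) ℂ) (MvPolynomial (Fin 3) ℂ)} {e : ℕ}
    (h : HasRatFirstIntegral D e) (a : ℂ) : HasRatFirstIntegral (a • D) e := by
  obtain ⟨F, G, hF, hG, hli, hFG⟩ := h
  refine ⟨F, G, hF, hG, hli, ?_⟩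
  simp only [Derivation.smul_apply, mul_smul_comm, hFG]

lemma affinePoint_ne_zero (s : ℂ) : ![s, 1] ≠ 0 := fun h => by
  simpa using congrFun h 1

/-- The point `[s:1]` of the projective line. -/
noncomputable def affinePoint (s : ℂ) : Projectivization ℂ (Fin 2 → ℂ) :=
  Projectivization.mk ℂ ![s, 1] (affinePoint_ne_zero s)

lemma affinePoint_injective : Function.Injective affinePoint := by
  intro s t h
  obtain ⟨a, ha⟩ := (Projectivization.mk_eq_mk_iff' ℂ _ _ _ _).mp h
  have h1 : a = 1 := by simpa using congrFun ha 1
  have h0 : a * t = s := by simpa using congrFun ha 0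
  rw [← h0, h1, one_mul]

/-- For a pencil `s·Dx + t·Dy` of homogeneous derivations of degree `m`, none of which
(for `(s,t) ≠ (0,0)`) is a polynomial multiple of the Euler derivation: if for each `d` only
finitely many members of the pencil admit a rational first integral of degree `≤ d`, then
the number of such members grows at most like `C·d⁴`. -/
theorem extactic_stmt_11
    (Dx Dy : Derivation ℂ (MvPolynomial (Fin 3) ℂ) (MvPolynomial (Fin 3) ℂ))
    (m : ℕ) (hm : 1 ≤ m)
    (hXhom : ∀ i : Fin 3, (Dx (X i)).IsHomogeneous m)
    (hYhom : ∀ i : Fin 3, (Dy (X i)).IsHomogeneous m)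
    (hEuler : ∀ s t : ℂ, (s, t) ≠ (0, 0) →
      ¬ ∃ h : MvPolynomial (Fin 3) ℂ, ∀ i : Fin 3, (s • Dx + t • Dy) (X i) = X i * h)
    (hfin : ∀ d : ℕ, 1 ≤ d → (FIParams Dx Dy d).Finite) :
    ∃ C : ℕ, 0 < C ∧ ∀ d : ℕ, 1 ≤ d → (FIParams Dx Dy d).ncard ≤ C * d ^ 4 := by
  classical
  refine ⟨17, by norm_num, fun d hd => ?_⟩
  obtain ⟨n, f, hn, hf, hli, hspan⟩ := exists_homogeneous_family d
  obtain ⟨p, hp, hps⟩ := exists_polynomial_det (projDerivation Dx) (projDerivation Dy) f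
  have hproj : ∀ s : ℂ, s • projDerivation Dx + projDerivation Dy
      = projDerivation (s • Dx + (1 : ℂ) • Dy) := fun s => by
    rw [projDerivation_smul_add, one_smul]
  have hp0 : p ≠ 0 := by
    rintro rfl
    have key : ∀ s : ℂ, ∃ e, 1 ≤ e ∧ affinePoint s ∈ FIParams Dx Dy e := by
      intro s
      have h0 := (hps s).symm
      rw [Polynomial.eval_zero, hproj] at h0
      obtain ⟨e, he, h⟩ := exists_firstIntegral_of_det_eq_zero
        (projDerivation_isHomogeneous (m := m) fun i => by
          simp only [Derivation.add_apply, Derivation.smul_apply, smul_eq_C_mul]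
          exact (IsHomogeneous.C_mul (hXhom i) s).add (IsHomogeneous.C_mul (hYhom i) 1))
        hd f hf hli h0
      exact ⟨e, he, s, 1, affinePoint_ne_zero s, rfl, e, he, le_rfl,
        (projDerivation_firstIntegral_iff _ _).mp h⟩
    have hcount : (⋃ e : ℕ, affinePoint ⁻¹' FIParams Dx Dy (e + 1)).Countable :=
      Set.countable_iUnion fun e =>
        ((hfin (e + 1) (by omega)).preimage affinePoint_injective.injOn).countable
    refine not_countable_complex (hcount.mono fun s _ => ?_)
    obtain ⟨e, he, hs⟩ := key s
    exact Set.mem_iUnion.mpr ⟨e - 1, by rwa [Set.mem_preimage, Nat.sub_add_cancel he]⟩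
  have h10 : (![1, 0] : Fin 2 → ℂ) ≠ 0 := fun h => by simpa using congrFun h 0
  have hsub : FIParams Dx Dy d ⊆
      ((insert (Projectivization.mk ℂ ![1, 0] h10)
        (p.roots.toFinset.image fun q => affinePoint (coeff 0 q)) : Finset _) : Set _) := by
    rintro P ⟨s, t, hst, rfl, e, he, hed, h⟩
    rw [Finset.mem_coe, Finset.mem_insert, Finset.mem_image]
    by_cases ht : t = 0
    · left
      rw [Projectivization.mk_eq_mk_iff']
      exact ⟨s, by simp [ht]⟩
    · right
      refine ⟨C (s / t), ?_, ?_⟩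
      · rw [Multiset.mem_toFinset, Polynomial.mem_roots hp0, Polynomial.IsRoot, hps, hproj]
        have h1 := h.smul t⁻¹
        rw [smul_add, smul_smul, smul_smul, inv_mul_cancel₀ ht, ← div_eq_inv_mul] at h1
        obtain ⟨F, G, hF, hG, hFG, hD⟩ :=
          ((projDerivation_firstIntegral_iff _ _).mpr h1).of_le_of_map_X_two hed
            (projDerivation_X_two _)
        obtain ⟨a, ha⟩ := hspan F hF
        obtain ⟨b, hb⟩ := hspan G hG
        exact det_eq_zero_of_firstIntegral f a b ha hb hFG hD
      · rw [coeff_zero_C, affinePoint, Projectivization.mk_eq_mk_iff']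
        refine ⟨t⁻¹, ?_⟩
        simp [ht, div_eq_inv_mul]
  have hcard : (FIParams Dx Dy d).ncard ≤ n * n + 1 := by
    refine (Set.ncard_le_ncard hsub (Finset.finite_toSet _)).trans ?_
    rw [Set.ncard_coe_finset]
    refine (Finset.card_insert_le _ _).trans (Nat.succ_le_succ ?_)
    exact Finset.card_image_le.trans ((Multiset.toFinset_card_le _).trans
      ((Polynomial.card_roots' p).trans hp))
  have hn4 : n ≤ 4 * d ^ 2 := hn.trans (by nlinarith)
  calc (FIParams Dx Dy d).ncard ≤ n * n + 1 := hcard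
    _ ≤ (4 * d ^ 2) * (4 * d ^ 2) + d ^ 4 :=
        Nat.add_le_add (Nat.mul_le_mul hn4 hn4) (Nat.one_le_pow _ _ hd)
    _ = 17 * d ^ 4 := by ring
end

section
/- Let X and Y be derivations on ℂ[x,y,z], let d ≥ 1, and set N = (d+1)(d+2)/2. Suppose there exists (s₀,t₀) ∈ ℂ² such that the d-th extactic polynomial E_d(s₀X + t₀Y) is nonzero. Then the set of points [s:t] in the projectivization of ℂ² such that E_d(sX + tY) = 0 is finite and has cardinality at most N(N−1)/2. -/
open MvPolynomial

/-- The `n`-th extactic polynomial of a derivation `D` on `ℂ[x,y,z]`, with respect to an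
enumeration `mono` of the exponents of the `(n+1)(n+2)/2` monomials of degree `n`. -/
noncomputable def extactic
    (D : Derivation ℂ (MvPolynomial (Fin 3) ℂ) (MvPolynomial (Fin 3) ℂ)) (n : ℕ)
    (mono : Fin ((n + 1) * (n + 2) / 2) → (Fin 3 →₀ ℕ)) : MvPolynomial (Fin 3) ℂ :=
  Matrix.det (Matrix.of fun i j : Fin ((n + 1) * (n + 2) / 2) =>
    (⇑D)^[(i : ℕ)] (monomial (mono j) (1 : ℂ)))

/-- Iterates along a line of derivations depend polynomially on the parameter:
`(Z + uW)^i a` is a polynomial in `u` of degree at most `i` with `i`-th coefficient `W^i a`. -/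
theorem exists_polynomial_iterate_add_smul {A : Type*} [CommRing A] [Algebra ℂ A]
    (Z W : Derivation ℂ A A) (a : A) (i : ℕ) :
    ∃ P : Polynomial A, P.natDegree ≤ i ∧ P.coeff i = (⇑W)^[i] a ∧
      ∀ u : ℂ, P.eval (algebraMap ℂ A u) = (⇑(Z + u • W))^[i] a := by
  induction i with
  | zero => exact ⟨Polynomial.C a, by simp, by simp, by simp⟩
  | succ i ih =>
    obtain ⟨P, hdeg, hcoeff, heval⟩ := ih
    have hsum (D : Derivation ℂ A A) :
        (∑ j ∈ Finset.range (i + 1),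
          Polynomial.C (D (P.coeff j)) * Polynomial.X ^ j).natDegree ≤ i :=
      Polynomial.natDegree_sum_le_of_forall_le _ _ fun j hj =>
        (Polynomial.natDegree_C_mul_X_pow_le _ _).trans (by simpa [Nat.lt_succ_iff] using hj)
    refine ⟨∑ j ∈ Finset.range (i + 1), Polynomial.C (Z (P.coeff j)) * Polynomial.X ^ j +
      (∑ j ∈ Finset.range (i + 1), Polynomial.C (W (P.coeff j)) * Polynomial.X ^ j) *
        Polynomial.X, ?_, ?_, fun u => ?_⟩
    · refine Polynomial.natDegree_add_le_of_degree_le ((hsum Z).trans i.le_succ) ?_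
      exact Polynomial.natDegree_mul_le_of_le (hsum W) Polynomial.natDegree_X_le
    · rw [Polynomial.coeff_add, Polynomial.coeff_mul_X,
        Polynomial.coeff_eq_zero_of_natDegree_lt (Nat.lt_succ_of_le (hsum Z)),
        Function.iterate_succ_apply', ← hcoeff]
      simp [Polynomial.coeff_X_pow]
    · have hpow (D : Derivation ℂ A A) (j : ℕ) :
          D (P.coeff j * algebraMap ℂ A u ^ j) = D (P.coeff j) * algebraMap ℂ A u ^ j := by
        rw [← map_pow, mul_comm, ← Algebra.smul_def, D.map_smul, Algebra.smul_def, mul_comm]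
      rw [Function.iterate_succ_apply', ← heval u,
        Polynomial.eval_eq_sum_range' (Nat.lt_succ_of_le hdeg)]
      simp only [Derivation.add_apply, Derivation.smul_apply, map_sum, hpow, Polynomial.eval_add,
        Polynomial.eval_mul, Polynomial.eval_finsetSum, Polynomial.eval_C, Polynomial.eval_pow,
        Polynomial.eval_X, Algebra.smul_def]
      rw [Finset.sum_mul, ← Finset.sum_add_distrib]
      exact Finset.sum_congr rfl fun j _ => by ring

theorem Polynomial.coeff_prod_sum_of_natDegree_le {R ι : Type*} [CommSemiring R]
    (s : Finset ι) (f : ι → Polynomial R) (n : ι → ℕ) (h : ∀ i ∈ s, (f i).natDegree ≤ n i) :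
    (∏ i ∈ s, f i).natDegree ≤ ∑ i ∈ s, n i ∧
      (∏ i ∈ s, f i).coeff (∑ i ∈ s, n i) = ∏ i ∈ s, (f i).coeff (n i) := by
  classical
  induction s using Finset.induction_on with
  | empty => simp
  | insert a s ha ih =>
    obtain ⟨h1, h2⟩ := ih fun i hi => h i (Finset.mem_insert_of_mem hi)
    have h3 := h a (Finset.mem_insert_self a s)
    simp only [Finset.prod_insert ha, Finset.sum_insert ha]
    exact ⟨Polynomial.natDegree_mul_le_of_le h3 h1,
      by rw [Polynomial.coeff_mul_add_eq_of_natDegree_le h3 h1, h2]⟩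

/-- A determinant whose `i`-th row has degree at most `r i` has degree at most `∑ i, r i`, and the
coefficient in that degree is the determinant of the row-wise top coefficients. -/
theorem Matrix.natDegree_det_le_and_coeff_det {R n : Type*} [CommRing R] [Fintype n]
    [DecidableEq n] (M : Matrix n n (Polynomial R)) (r : n → ℕ)
    (h : ∀ i j, (M i j).natDegree ≤ r i) :
    M.det.natDegree ≤ ∑ i, r i ∧
      M.det.coeff (∑ i, r i) = (Matrix.of fun i j => (M i j).coeff (r i)).det := by
  have key (σ : Equiv.Perm n) := Polynomial.coeff_prod_sum_of_natDegree_le Finset.univ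
    (fun i => M.transpose (σ i) i) r fun i _ => h i _
  rw [← Matrix.det_transpose M, ← Matrix.det_transpose (Matrix.of _)]
  simp only [Matrix.det_apply]
  constructor
  · refine Polynomial.natDegree_sum_le_of_forall_le _ _ fun σ _ => ?_
    exact (Polynomial.natDegree_smul_le _ _).trans (key σ).1
  · simp only [Polynomial.finsetSum_coeff, Polynomial.coeff_smul, (key _).2]
    rfl

/-- Along the affine line `Z + uW` of derivations, the extactic polynomial is polynomial in `u`,
and its coefficient of degree `N(N-1)/2` is the extactic polynomial of `W`. -/
theorem exists_polynomial_extactic_add_smul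
    (Z W : Derivation ℂ (MvPolynomial (Fin 3) ℂ) (MvPolynomial (Fin 3) ℂ)) (d : ℕ)
    (mono : Fin ((d + 1) * (d + 2) / 2) → (Fin 3 →₀ ℕ)) :
    ∃ F : Polynomial (MvPolynomial (Fin 3) ℂ),
      F.natDegree ≤ ((d + 1) * (d + 2) / 2) * ((d + 1) * (d + 2) / 2 - 1) / 2 ∧
      F.coeff (((d + 1) * (d + 2) / 2) * ((d + 1) * (d + 2) / 2 - 1) / 2) = extactic W d mono ∧
      ∀ u : ℂ, F.eval (C u) = extactic (Z + u • W) d mono := by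
  choose P hdeg hcoeff heval using fun (i j : Fin ((d + 1) * (d + 2) / 2)) =>
    exists_polynomial_iterate_add_smul Z W (monomial (mono j) (1 : ℂ)) (i : ℕ)
  have hsum : ∑ i : Fin ((d + 1) * (d + 2) / 2), (i : ℕ) =
      ((d + 1) * (d + 2) / 2) * ((d + 1) * (d + 2) / 2 - 1) / 2 := by
    rw [Fin.sum_univ_eq_sum_range (fun i => i), Finset.sum_range_id]
  obtain ⟨h1, h2⟩ :=
    Matrix.natDegree_det_le_and_coeff_det (Matrix.of P) (fun i => (i : ℕ)) hdeg
  rw [hsum] at h1 h2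
  refine ⟨(Matrix.of P).det, h1, ?_, fun u => ?_⟩
  · rw [h2, extactic]
    congr 1
    ext1 i j
    exact hcoeff i j
  · rw [← Polynomial.coe_evalRingHom, RingHom.map_det, extactic]
    congr 1
    ext1 i j
    exact heval i j u

theorem extactic_smul_eq_zero_iff
    (D : Derivation ℂ (MvPolynomial (Fin 3) ℂ) (MvPolynomial (Fin 3) ℂ)) (d : ℕ)
    (mono : Fin ((d + 1) * (d + 2) / 2) → (Fin 3 →₀ ℕ)) {a : ℂ} (ha : a ≠ 0) :
    extactic (a • D) d mono = 0 ↔ extactic D d mono = 0 := by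
  have hiter (i : ℕ) (p : MvPolynomial (Fin 3) ℂ) :
      (⇑(a • D))^[i] p = C (a ^ i) * (⇑D)^[i] p := by
    induction i with
    | zero => simp
    | succ i ih =>
      rw [Function.iterate_succ_apply', Function.iterate_succ_apply', ih, ← smul_eq_C_mul,
        ← smul_eq_C_mul, Derivation.map_smul, Derivation.smul_apply, smul_smul, pow_succ]
  have hdet : extactic (a • D) d mono =
      (∏ i : Fin ((d + 1) * (d + 2) / 2), C (a ^ (i : ℕ))) * extactic D d mono := by
    rw [extactic, extactic, ← Matrix.det_mul_column]
    congr 1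
    ext1 i j
    exact hiter i _
  rw [hdet, mul_eq_zero, or_iff_right]
  exact Finset.prod_ne_zero_iff.2 fun i _ => by simp [ha]

theorem extactic_zero (d : ℕ) (hd : 1 ≤ d)
    (mono : Fin ((d + 1) * (d + 2) / 2) → (Fin 3 →₀ ℕ)) : extactic 0 d mono = 0 := by
  have h : 1 < (d + 1) * (d + 2) / 2 := by
    rw [Nat.lt_iff_add_one_le, Nat.le_div_iff_mul_le two_pos]
    nlinarith
  exact Matrix.det_eq_zero_of_row_eq_zero ⟨1, h⟩ fun j => by simp

/-- If some member `s₀·Dx + t₀·Dy` of a pencil of derivations has nonzero `d`-th extactic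
polynomial, then the set of points `[s:t]` of the projective line for which
`E_d(s·Dx + t·Dy) = 0` is finite of cardinality at most `N(N−1)/2`, `N = (d+1)(d+2)/2`. -/
theorem extactic_stmt_12
    (Dx Dy : Derivation ℂ (MvPolynomial (Fin 3) ℂ) (MvPolynomial (Fin 3) ℂ))
    (d : ℕ) (hd : 1 ≤ d)
    (mono : Fin ((d + 1) * (d + 2) / 2) → (Fin 3 →₀ ℕ))
    (hinj : Function.Injective mono)
    (hdeg : ∀ j, ((mono j).sum fun _ e => e) = d)
    (h0 : ∃ s₀ t₀ : ℂ, extactic (s₀ • Dx + t₀ • Dy) d mono ≠ 0) :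
    ({P : Projectivization ℂ (Fin 2 → ℂ) |
        ∃ (s t : ℂ) (h : ![s, t] ≠ 0), P = Projectivization.mk ℂ ![s, t] h ∧
          extactic (s • Dx + t • Dy) d mono = 0}).Finite ∧
    ({P : Projectivization ℂ (Fin 2 → ℂ) |
        ∃ (s t : ℂ) (h : ![s, t] ≠ 0), P = Projectivization.mk ℂ ![s, t] h ∧
          extactic (s • Dx + t • Dy) d mono = 0}).ncard ≤
      ((d + 1) * (d + 2) / 2) * ((d + 1) * (d + 2) / 2 - 1) / 2 := by
  obtain ⟨s₀, t₀, hq⟩ := h0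
  obtain ⟨p, p', hp⟩ : ∃ p p' : ℂ, p * t₀ - p' * s₀ ≠ 0 := by
    by_contra! h
    have ht : t₀ = 0 := by simpa using h 1 0
    have hs : s₀ = 0 := by simpa using h 0 1
    exact hq (by simpa [hs, ht] using extactic_zero d hd mono)
  obtain ⟨F, hdegF, hcoeff, heval⟩ := exists_polynomial_extactic_add_smul
    (p • Dx + p' • Dy) (s₀ • Dx + t₀ • Dy) d mono
  have hF : F ≠ 0 := by
    rintro rfl
    exact hq (by simpa using hcoeff.symm)
  have hne (u : ℂ) : ![p + u * s₀, p' + u * t₀] ≠ 0 := by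
    intro h
    have e0 : p + u * s₀ = 0 := by simpa using congrFun h 0
    have e1 : p' + u * t₀ = 0 := by simpa using congrFun h 1
    exact hp (by linear_combination t₀ * e0 - s₀ * e1)
  classical
  set U : Finset ℂ := F.roots.toFinset.preimage C (C_injective (Fin 3) ℂ).injOn with hU
  have hcardU : U.card ≤ ((d + 1) * (d + 2) / 2) * ((d + 1) * (d + 2) / 2 - 1) / 2 :=
    calc U.card ≤ F.roots.toFinset.card :=
          Finset.card_le_card_of_injOn C (fun u hu => Finset.mem_preimage.1 hu)
            (C_injective (Fin 3) ℂ).injOn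
      _ ≤ F.roots.card := F.roots.toFinset_card_le
      _ ≤ F.natDegree := F.card_roots'
      _ ≤ _ := hdegF
  set T : Finset (Projectivization ℂ (Fin 2 → ℂ)) :=
    U.image fun u => Projectivization.mk ℂ ![p + u * s₀, p' + u * t₀] (hne u) with hT
  have hsub : {P : Projectivization ℂ (Fin 2 → ℂ) |
      ∃ (s t : ℂ) (h : ![s, t] ≠ 0), P = Projectivization.mk ℂ ![s, t] h ∧
        extactic (s • Dx + t • Dy) d mono = 0} ⊆ (T : Set _) := by
    rintro P ⟨s, t, h, rfl, hE⟩
    obtain ⟨a, b, rfl, rfl⟩ : ∃ a b : ℂ, s = a * p + b * s₀ ∧ t = a * p' + b * t₀ :=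
      ⟨(s * t₀ - t * s₀) / (p * t₀ - p' * s₀), (p * t - p' * s) / (p * t₀ - p' * s₀),
        by rw [div_mul_eq_mul_div, div_mul_eq_mul_div, ← add_div, eq_div_iff hp]; ring,
        by rw [div_mul_eq_mul_div, div_mul_eq_mul_div, ← add_div, eq_div_iff hp]; ring⟩
    by_cases ha : a = 0
    · subst ha
      have hb : b ≠ 0 := by
        rintro rfl
        exact h (by simp)
      refine absurd ((extactic_smul_eq_zero_iff (s₀ • Dx + t₀ • Dy) d mono hb).1 ?_) hq
      rw [← hE]
      congr 1
      module
    · have hu : extactic (p • Dx + p' • Dy + (b / a) • (s₀ • Dx + t₀ • Dy)) d mono = 0 := by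
        refine (extactic_smul_eq_zero_iff _ d mono ha).1 ?_
        rw [← hE]
        congr 1
        match_scalars <;> field_simp
      refine Finset.mem_coe.2 (Finset.mem_image.2 ⟨b / a, ?_, ?_⟩)
      · rw [hU, Finset.mem_preimage, Multiset.mem_toFinset, Polynomial.mem_roots hF,
          Polynomial.IsRoot.def, heval, hu]
      · rw [Projectivization.mk_eq_mk_iff']
        refine ⟨a⁻¹, ?_⟩
        ext i
        fin_cases i <;> simp <;> field_simp
  exact ⟨T.finite_toSet.subset hsub, (Set.ncard_le_ncard hsub T.finite_toSet).trans
    ((Set.ncard_coe_finset T).le.trans (Finset.card_image_le.trans hcardU))⟩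
end

section
/- Let X be a derivation on ℂ[x₁,…,x_q], let f, g ∈ ℂ[x₁,…,x_q] with X(f) = g·f, let k ≥ 1, and let v : Fin k → ℂ[x₁,…,x_q] be a family of polynomials. If f divides some nonzero ℂ-linear combination of v_1, …, v_k, then f divides the determinant of the k×k matrix over ℂ[x₁,…,x_q] whose (i,j)-entry is X^i(v_j) (for 0 ≤ i ≤ k−1, 0 ≤ j ≤ k−1). (Every invariant hypersurface contained in the zero locus of some element of a linear system V is contained in the zero locus of the extactic divisor of V.) -/
open MvPolynomial

/-- An ideal `(f)` stable under a derivation `D` at its generator is stable under its iterates. -/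
theorem Derivation.dvd_iterate_of_dvd {R A : Type*} [CommRing R] [CommRing A] [Algebra R A]
    (D : Derivation R A A) {f p : A} (hf : f ∣ D f) (hp : f ∣ p) (n : ℕ) :
    f ∣ (⇑D)^[n] p := by
  induction n with
  | zero => exact hp
  | succ n ih =>
    rw [Function.iterate_succ_apply']
    obtain ⟨r, hr⟩ := ih
    rw [hr, D.leibniz, smul_eq_mul, smul_eq_mul]
    exact dvd_add (dvd_mul_right _ _) (hf.mul_left _)

/-- If `f` divides every entry of `M *ᵥ w`, then it divides every entry of `det M • w`. -/
theorem Matrix.dvd_det_mul_of_dvd_mulVec {n A : Type*} [Fintype n] [DecidableEq n] [CommRing A]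
    (M : Matrix n n A) (w : n → A) {f : A} (h : ∀ i, f ∣ (M.mulVec w) i) (j : n) :
    f ∣ M.det * w j := by
  have key : M.adjugate.mulVec (M.mulVec w) = M.det • w := by
    rw [Matrix.mulVec_mulVec, Matrix.adjugate_mul, Matrix.smul_mulVec, Matrix.one_mulVec]
  rw [← smul_eq_mul, ← Pi.smul_apply, ← key]
  exact Finset.dvd_sum fun i _ => (h i).mul_left _

/-- If `f` is invariant by the derivation `D` (i.e. `D f = g·f`) and `f` divides some
nonzero `ℂ`-linear combination of `v₁, …, v_k`, then `f` divides the extactic determinant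
`det (D^i (v j))`: every invariant hypersurface contained in the zero locus of some element
of a linear system is contained in the zero locus of the extactic divisor of the system. -/
theorem extactic_stmt_15 (q : ℕ)
    (D : Derivation ℂ (MvPolynomial (Fin q) ℂ) (MvPolynomial (Fin q) ℂ))
    (f g : MvPolynomial (Fin q) ℂ) (hf : D f = g * f)
    (k : ℕ) (hk : 1 ≤ k) (v : Fin k → MvPolynomial (Fin q) ℂ)
    (h : ∃ a : Fin k → ℂ, (∑ j, a j • v j) ≠ 0 ∧ f ∣ ∑ j, a j • v j) :
    f ∣ Matrix.det (Matrix.of fun i j : Fin k => (⇑D)^[(i : ℕ)] (v j)) := by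
  obtain ⟨a, hne, hdvd⟩ := h
  obtain ⟨j, hj⟩ : ∃ j, a j ≠ 0 := by
    by_contra! ha
    exact hne (by simp [ha])
  have hiter : ∀ n : ℕ, (⇑D)^[n] (∑ j, a j • v j) = ∑ j, a j • (⇑D)^[n] (v j) := by
    intro n
    induction n with
    | zero => rfl
    | succ n ih => simp only [Function.iterate_succ_apply', ih, map_sum, D.map_smul]
  have hdet := Matrix.dvd_det_mul_of_dvd_mulVec
    (Matrix.of fun i j : Fin k => (⇑D)^[(i : ℕ)] (v j)) (fun j => C (a j)) (f := f) (fun i => by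
      have hi := D.dvd_iterate_of_dvd (Dvd.intro_left g hf.symm) hdvd i
      rw [hiter] at hi
      simpa [Matrix.mulVec, dotProduct, smul_eq_C_mul, mul_comm] using hi) j
  exact ((hj.isUnit.map C).dvd_mul_right).mp hdet
end
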